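/- ∑_{k=0}^∞ (5/2)_k^2 (−3/2)_k / [(k!)^2 · (k+2)!] · (6k+5)/(−8)^k = 32√2/(3π). -/

import Mathlib

/-- The Pochhammer symbol `(x)ₖ = x (x+1) ⋯ (x+k-1)`, with `(x)₀ = 1`. -/
noncomputable def poch (x : ℝ) (k : ℕ) : ℝ :=
  ∏ i ∈ Finset.range k, (x + i)

open Filter Topology Finset in
theorem poch_gamma_quotient_tendsto :
    Tendsto (fun n : ℕ => poch (7/4) n * poch (9/4) n / (poch 3 n * poch 1 n)) atTop
      (𝓝 (Real.Gamma 3 * Real.Gamma 1 / (Real.Gamma (7/4) * Real.Gamma (9/4)))) := by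
  rw [← tendsto_add_atTop_iff_nat 1]
  have h := ((Real.GammaSeq_tendsto_Gamma 3).mul (Real.GammaSeq_tendsto_Gamma 1)).div
    ((Real.GammaSeq_tendsto_Gamma (7/4)).mul (Real.GammaSeq_tendsto_Gamma (9/4)))
    (mul_pos (Real.Gamma_pos_of_pos (by norm_num)) (Real.Gamma_pos_of_pos (by norm_num))).ne'
  refine h.congr' ?_
  filter_upwards [eventually_ge_atTop 1] with n hn
  have hn' : (0 : ℝ) < n := by exact_mod_cast hn
  have hpos (x : ℝ) (hx : 0 < x) : poch x (n + 1) ≠ 0 :=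
    (Finset.prod_pos fun i _ => by positivity).ne'
  have h3 := hpos 3 (by norm_num)
  have h1 := hpos 1 (by norm_num)
  have h7 := hpos (7/4) (by norm_num)
  have h9 := hpos (9/4) (by norm_num)
  have hf : (n.factorial : ℝ) ≠ 0 := by positivity
  have hp : (n : ℝ) ^ (3 : ℝ) * (n : ℝ) ^ (1 : ℝ) = (n : ℝ) ^ (7/4 : ℝ) * (n : ℝ) ^ (9/4 : ℝ) := by
    rw [← Real.rpow_add hn', ← Real.rpow_add hn']; norm_num
  have e (s : ℝ) : Real.GammaSeq s n = (n : ℝ) ^ s * n.factorial / poch s (n + 1) := rfl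
  simp only [Pi.div_apply, e]
  have p7 : (n : ℝ) ^ (7/4 : ℝ) ≠ 0 := (Real.rpow_pos_of_pos hn' _).ne'
  have p9 : (n : ℝ) ^ (9/4 : ℝ) ≠ 0 := (Real.rpow_pos_of_pos hn' _).ne'
  generalize (n : ℝ) ^ (7/4 : ℝ) = a at *
  generalize (n : ℝ) ^ (9/4 : ℝ) = b at *
  generalize (n : ℝ) ^ (3 : ℝ) = c at *
  generalize (n : ℝ) ^ (1 : ℝ) = d at *
  rw [div_mul_div_comm, div_mul_div_comm, div_div_div_eq,
    div_eq_div_iff (by positivity) (by positivity)]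
  linear_combination n.factorial ^ 2 * poch (7/4) (n+1) * poch (9/4) (n+1) * poch 3 (n+1) *
    poch 1 (n+1) * hp

theorem gamma_quotient_eq :
    Real.Gamma 3 * Real.Gamma 1 / (Real.Gamma (7/4) * Real.Gamma (9/4)) =
      64 * Real.sqrt 2 / (15 * Real.pi) := by
  have h3 : Real.Gamma 3 = 2 := by
    norm_num [Nat.factorial]
  have h7 : Real.Gamma (7/4) = 3/4 * Real.Gamma (3/4) := by
    rw [← Real.Gamma_add_one (by norm_num)]; norm_num
  have h9 : Real.Gamma (9/4) = 5/4 * (1/4 * Real.Gamma (1/4)) := by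
    rw [show (9/4 : ℝ) = 1/4 + 1 + 1 by norm_num, Real.Gamma_add_one (by norm_num),
      Real.Gamma_add_one (by norm_num)]
    norm_num
  have hr := Real.Gamma_mul_Gamma_one_sub (1/4)
  rw [show Real.pi * (1/4) = Real.pi / 4 by ring, Real.sin_pi_div_four,
    show (1 - 1/4 : ℝ) = 3/4 by norm_num] at hr
  have hden : Real.Gamma (7/4) * Real.Gamma (9/4) = 15/64 * (Real.pi / (√2 / 2)) := by
    rw [h7, h9, ← hr]; ring
  rw [hden, h3, Real.Gamma_one]
  have := Real.pi_ne_zero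
  have : √2 ≠ 0 := by positivity
  field_simp

theorem poch_succ (x : ℝ) (k : ℕ) : poch x (k + 1) = poch x k * (x + k) :=
  Finset.prod_range_succ _ _

theorem poch_succ' (x : ℝ) (k : ℕ) : poch x (k + 1) = x * poch (x + 1) k := by
  unfold poch
  rw [Finset.prod_range_succ', mul_comm]
  congr 1
  · simp
  · exact Finset.prod_congr rfl fun i _ => by push_cast; ring

theorem poch_pos {x : ℝ} (hx : 0 < x) (k : ℕ) : 0 < poch x k :=
  Finset.prod_pos fun i _ => by positivity

theorem poch_neg_eq_zero {n k : ℕ} (h : n < k) : poch (-(n : ℝ)) k = 0 :=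
  Finset.prod_eq_zero (Finset.mem_range.mpr h) (by simp)

/-- The hypergeometric coefficient of the series, at argument `1/4`. -/
noncomputable def hypCoeff (k : ℕ) : ℝ :=
  poch (5/2) k ^ 2 * poch (-(3/2)) k /
    ((k.factorial : ℝ) ^ 2 * ((k + 2).factorial : ℝ)) / 4 ^ k

theorem hypCoeff_succ (k : ℕ) :
    hypCoeff (k + 1) = hypCoeff k *
      ((k + 5/2) ^ 2 * (k - 3/2) / (4 * (k + 1) ^ 2 * (k + 3))) := by
  unfold hypCoeff
  rw [poch_succ, poch_succ, Nat.factorial_succ, show k + 1 + 2 = (k + 2) + 1 by ring,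
    Nat.factorial_succ (k + 2)]
  have : (k.factorial : ℝ) ≠ 0 := by positivity
  have : ((k + 2).factorial : ℝ) ≠ 0 := by positivity
  push_cast
  field_simp
  ring

/-- The factor that truncates the series after the index `n`. -/
noncomputable def truncFactor (n k : ℕ) : ℝ :=
  poch (-(n : ℝ)) k / poch (7/2 + 2 * n) k

theorem truncFactor_eq_prod (n k : ℕ) :
    truncFactor n k = ∏ i ∈ Finset.range k, ((-(n : ℝ) + i) / (7/2 + 2 * n + i)) :=
  (Finset.prod_div_distrib _ _).symm

theorem abs_truncFactor_le (n k : ℕ) : |truncFactor n k| ≤ (1/2) ^ k := by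
  rw [truncFactor_eq_prod, Finset.abs_prod]
  by_cases h : k ≤ n
  · calc _ ≤ ∏ _i ∈ Finset.range k, (1/2 : ℝ) := by
          refine Finset.prod_le_prod (fun _ _ => abs_nonneg _) fun i hi => ?_
          have hi' : (i : ℝ) ≤ n := by
            exact_mod_cast ((Finset.mem_range.mp hi).trans_le h).le
          rw [abs_div, abs_of_nonpos (by linarith), abs_of_pos (by positivity),
            div_le_div_iff₀ (by positivity) (by norm_num)]
          linarith [(Nat.cast_nonneg i : (0 : ℝ) ≤ i)]
      _ = _ := by simp
  · rw [Finset.prod_eq_zero (Finset.mem_range.mpr (not_le.mp h)) (by simp)]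
    positivity

open Filter Topology in
theorem truncFactor_tendsto (k : ℕ) :
    Tendsto (fun n => truncFactor n k) atTop (𝓝 ((-1/2) ^ k)) := by
  simp only [truncFactor_eq_prod]
  rw [show ((-1/2 : ℝ)) ^ k = ∏ _i ∈ Finset.range k, (-1/2 : ℝ) by
    rw [Finset.prod_const, Finset.card_range]]
  refine tendsto_finsetProd _ fun i _ => ?_
  have h : Tendsto (fun n : ℕ => -1/2 + (7/4 + 3/2 * (i : ℝ)) / (7/2 + 2 * (n : ℝ) + i)) atTop
      (𝓝 (-1/2 + 0)) := by
    refine tendsto_const_nhds.add (Tendsto.div_atTop tendsto_const_nhds ?_)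
    refine tendsto_atTop_mono (fun n => ?_) tendsto_natCast_atTop_atTop
    linarith [(Nat.cast_nonneg i : (0 : ℝ) ≤ i), (Nat.cast_nonneg n : (0 : ℝ) ≤ n)]
  rw [add_zero] at h
  refine h.congr fun n => ?_
  have : (7/2 + 2 * (n : ℝ) + i) ≠ 0 := by positivity
  field_simp
  ring

theorem summable_bound : Summable fun k : ℕ => |hypCoeff k * (6 * k + 5)| * (1/2) ^ k := by
  refine summable_of_ratio_norm_eventually_le (r := 1/2) (by norm_num) ?_
  filter_upwards [Filter.eventually_ge_atTop 2] with k hk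
  obtain ⟨m, rfl⟩ := Nat.exists_eq_add_of_le' hk
  rw [hypCoeff_succ, pow_succ (1/2 : ℝ)]
  simp only [norm_mul, Real.norm_eq_abs, abs_abs, abs_mul]
  have h1 : |((m + 2 : ℕ) + 5/2 : ℝ) ^ 2 * ((m + 2 : ℕ) - 3/2) /
      (4 * ((m + 2 : ℕ) + 1) ^ 2 * ((m + 2 : ℕ) + 3))| * |6 * ((m + 2 + 1 : ℕ) : ℝ) + 5| ≤
      |6 * ((m + 2 : ℕ) : ℝ) + 5| := by
    push_cast
    have : (0 : ℝ) ≤ m + 2 - 3/2 := by linarith [(Nat.cast_nonneg m : (0 : ℝ) ≤ m)]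
    rw [abs_of_nonneg (by positivity), abs_of_nonneg (by positivity),
      abs_of_nonneg (by positivity), div_mul_eq_mul_div, div_le_iff₀ (by positivity),
      ← sub_nonneg]
    ring_nf
    positivity
  have h2 := mul_le_mul_of_nonneg_left h1
    (mul_nonneg (abs_nonneg (hypCoeff (m + 2))) (abs_nonneg ((1/2 : ℝ) ^ (m + 2))))
  have h3 : |(1/2 : ℝ)| = 1/2 := by norm_num
  rw [h3]
  linarith

theorem partial_sum_telescope (n K : ℕ) :
    ∑ k ∈ Finset.range (K + 1), hypCoeff k * (6 * k + 5) *
      ((n + 3) * (n + 1) * truncFactor (n + 1) k - (n + 7/4) * (n + 9/4) * truncFactor n k) =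
    hypCoeff K * (K + 5/2) ^ 2 * (K - 3/2) * poch (-(n : ℝ)) K / (2 * poch (11/2 + 2 * n) K) := by
  have hD (k : ℕ) : poch (11/2 + 2 * n) k ≠ 0 := (poch_pos (by positivity) k).ne'
  have hden (k : ℕ) : poch (7/2 + 2 * (n : ℝ)) k =
      (7/2 + 2 * n) * (9/2 + 2 * n) * poch (11/2 + 2 * n) k /
        ((7/2 + 2 * n + k) * (9/2 + 2 * n + k)) := by
    have h1 := poch_succ (7/2 + 2 * n) k
    have h2 := poch_succ' (7/2 + 2 * n) k
    have h3 := poch_succ (9/2 + 2 * n) k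
    have h4 := poch_succ' (9/2 + 2 * n) k
    rw [show (7/2 + 2 * n + 1 : ℝ) = 9/2 + 2 * n by ring] at h2
    rw [show (9/2 + 2 * n + 1 : ℝ) = 11/2 + 2 * n by ring] at h4
    rw [eq_div_iff (by positivity)]
    linear_combination (9/2 + 2 * (n : ℝ) + k) * (h2 - h1) + (7/2 + 2 * (n : ℝ)) * (h4 - h3)
  have hcast : (7/2 + 2 * ((n + 1 : ℕ) : ℝ)) = 11/2 + 2 * n := by push_cast; ring
  induction K with
  | zero =>
    simp [truncFactor, poch, hypCoeff]
    ring
  | succ K ih =>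
    rw [Finset.sum_range_succ, ih]
    have hn : poch (-((n + 1 : ℕ) : ℝ)) (K + 1) = -(n + 1) * poch (-(n : ℝ)) K := by
      rw [poch_succ', show (-((n + 1 : ℕ) : ℝ) + 1) = -n by push_cast; ring]
      push_cast
      ring
    simp only [truncFactor, hcast, hden, hn]
    rw [hypCoeff_succ, poch_succ (-(n : ℝ)), poch_succ (11/2 + 2 * (n : ℝ))]
    have := hD K
    generalize poch (11/2 + 2 * (n : ℝ)) K = D at *
    generalize poch (-(n : ℝ)) K = P
    generalize hypCoeff K = A
    push_cast
    have : (11/2 + 2 * (n : ℝ) + K) ≠ 0 := by positivity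
    have : (7/2 + 2 * (n : ℝ) + (K + 1)) ≠ 0 := by positivity
    have : (9/2 + 2 * (n : ℝ) + (K + 1)) ≠ 0 := by positivity
    have : (7/2 + 2 * (n : ℝ)) ≠ 0 := by positivity
    have : (9/2 + 2 * (n : ℝ)) ≠ 0 := by positivity
    field_simp
    ring

/-- The truncated series. -/
noncomputable def truncSum (n : ℕ) : ℝ :=
  ∑' k : ℕ, hypCoeff k * (6 * k + 5) * truncFactor n k

theorem truncSum_eq_sum {n m : ℕ} (h : n < m) :
    truncSum n = ∑ k ∈ Finset.range m, hypCoeff k * (6 * k + 5) * truncFactor n k := by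
  refine tsum_eq_sum fun k hk => ?_
  rw [truncFactor, poch_neg_eq_zero (h.trans_le (by simpa using hk))]
  simp

theorem truncSum_succ (n : ℕ) :
    (n + 3) * (n + 1) * truncSum (n + 1) = (n + 7/4) * (n + 9/4) * truncSum n := by
  have h := partial_sum_telescope n (n + 1)
  rw [poch_neg_eq_zero n.lt_succ_self, mul_zero, zero_div] at h
  rw [truncSum_eq_sum (show n + 1 < n + 1 + 1 by omega),
    truncSum_eq_sum (show n < n + 1 + 1 by omega), ← sub_eq_zero, Finset.mul_sum,
    Finset.mul_sum, ← Finset.sum_sub_distrib, ← h]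
  exact Finset.sum_congr rfl fun k _ => by ring

theorem truncSum_eq (n : ℕ) :
    truncSum n = 5/2 * (poch (7/4) n * poch (9/4) n / (poch 3 n * poch 1 n)) := by
  induction n with
  | zero =>
    rw [truncSum_eq_sum zero_lt_one]
    norm_num [hypCoeff, truncFactor, poch]
  | succ n ih =>
    have h := truncSum_succ n
    rw [ih] at h
    have h3 := (poch_pos (show (0 : ℝ) < 3 by norm_num) n).ne'
    have h1 := (poch_pos (show (0 : ℝ) < 1 by norm_num) n).ne'
    simp only [poch_succ]
    have e : truncSum (n + 1) = (n + 7/4) * (n + 9/4) *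
        (5/2 * (poch (7/4) n * poch (9/4) n / (poch 3 n * poch 1 n))) / ((n + 3) * (n + 1)) := by
      rw [eq_div_iff (by positivity), ← h]; ring
    rw [e]
    have : (3 + n : ℝ) ≠ 0 := by positivity
    have : (1 + n : ℝ) ≠ 0 := by positivity
    have : (n + 3 : ℝ) ≠ 0 := by positivity
    have : (n + 1 : ℝ) ≠ 0 := by positivity
    field_simp
    ring

open Filter Topology in
theorem truncSum_tendsto :
    Tendsto truncSum atTop (𝓝 (∑' k : ℕ, hypCoeff k * (6 * k + 5) * (-1/2) ^ k)) := by
  refine tendsto_tsum_of_dominated_convergence summable_bound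
    (fun k => (truncFactor_tendsto k).const_mul _) (Eventually.of_forall fun n k => ?_)
  rw [norm_mul, Real.norm_eq_abs, Real.norm_eq_abs]
  exact mul_le_mul_of_nonneg_left (abs_truncFactor_le n k) (abs_nonneg _)

theorem example_thm3_p1q1 :
    ∑' k : ℕ, (poch (5/2) k ^ 2 * poch (-(3/2)) k) / ((k.factorial : ℝ) ^ 2 * ((k + 2).factorial : ℝ)) * ((6*(k : ℝ) + 5) / (-8 : ℝ) ^ k) = 32 * Real.sqrt 2 / (3 * Real.pi) := by
  have hlim := truncSum_tendsto
  rw [funext truncSum_eq] at hlim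
  have h := tendsto_nhds_unique hlim (poch_gamma_quotient_tendsto.const_mul (5/2))
  rw [gamma_quotient_eq] at h
  calc _ = ∑' k : ℕ, hypCoeff k * (6 * k + 5) * (-1/2) ^ k := by
        refine tsum_congr fun k => ?_
        have h8 : (-1/2 : ℝ) ^ k / 4 ^ k = 1 / (-8) ^ k := by
          rw [← div_pow, ← one_div_pow]; norm_num
        rw [div_eq_mul_one_div (6 * (k : ℝ) + 5), ← h8, hypCoeff]
        ring
    _ = _ := by
        rw [h]
        have := Real.pi_ne_zero
        field_simp
        norm_num
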